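/- For any duplicative forests f and f', one has f ≪ f' if and only if f and f' have the same length ℓ and one of the following holds: (i) ℓ = 0; (ii) ℓ = 1, f = [W(g)] and f' = [B(g'·g'')] where g ≪ g' and g ≪ g''; (iii) ℓ = 1, f = [W(g)] and f' = [W(g')] with g ≪ g', or f = [B(g)] and f' = [B(g')] with g ≪ g'; (iv) ℓ ≥ 2 and f(i) ≪ f'(i) (as one-tree forests) for all positions i. -/

import Mathlib

/-- Mockingbird terms: the constant `M`, variables `x i`, and applications. -/
inductive MTerm : Type
  | M : MTerm
  | var : ℕ → MTerm
  | app : MTerm → MTerm → MTerm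
  deriving DecidableEq

/-- The one-step rewrite relation `⇒` on Mockingbird terms. -/
inductive Step : MTerm → MTerm → Prop
  | mock (t : MTerm) : Step (MTerm.app MTerm.M t) (MTerm.app t t)
  | left {t1 t1' : MTerm} (t2 : MTerm) :
      Step t1 t1' → Step (MTerm.app t1 t2) (MTerm.app t1' t2)
  | right (t1 : MTerm) {t2 t2' : MTerm} :
      Step t2 t2' → Step (MTerm.app t1 t2) (MTerm.app t1 t2')

/-- `≼`, the reflexive-transitive closure of `⇒`. -/
def MLe : MTerm → MTerm → Prop := Relation.ReflTransGen Step

/-- `≡`, the reflexive-symmetric-transitive closure of `⇒`. -/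
def MEquiv : MTerm → MTerm → Prop := Relation.EqvGen Step

/-- Strict version of `≼`. -/
def MLt (s t : MTerm) : Prop := MLe s t ∧ s ≠ t

/-- Covering relation for `≼`. -/
def MCovBy (s t : MTerm) : Prop := MLt s t ∧ ∀ z, MLt s z → ¬ MLt z t

/-- Duplicative trees: white or black nodes with a list (forest) of children. -/
inductive DTree : Type
  | W : List DTree → DTree
  | B : List DTree → DTree

/-- The one-step relation `⋖` on duplicative forests. -/
inductive DStep : List DTree → List DTree → Prop
  | dup (g : List DTree) : DStep [DTree.W g] [DTree.B (g ++ g)]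
  | white {g g' : List DTree} : DStep g g' → DStep [DTree.W g] [DTree.W g']
  | black {g g' : List DTree} : DStep g g' → DStep [DTree.B g] [DTree.B g']
  | head {t t' : DTree} (f : List DTree) : DStep [t] [t'] → DStep (t :: f) (t' :: f)
  | tail (t : DTree) {f f' : List DTree} : DStep f f' → DStep (t :: f) (t :: f')

/-- `≪`, the reflexive-transitive closure of `⋖`. -/
def DLe : List DTree → List DTree → Prop := Relation.ReflTransGen DStep

/-- The map `fr` from Mockingbird terms to duplicative forests. -/
def fr : MTerm → List DTree
  | MTerm.M => []
  | MTerm.var _ => []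
  | MTerm.app MTerm.M MTerm.M => [DTree.B []]
  | MTerm.app MTerm.M t' => [DTree.W (fr t')]
  | MTerm.app t t' => [DTree.B (fr t ++ fr t')]

mutual
  /-- The pruning map on duplicative trees (returns a forest). -/
  def prT : DTree → List DTree
    | DTree.W g => [DTree.W (prF g)]
    | DTree.B g => prF g
  /-- The pruning map on duplicative forests. -/
  def prF : List DTree → List DTree
    | [] => []
    | t :: f => prT t ++ prF f
end

mutual
  /-- The statistic `mtStat` on duplicative trees. -/
  def mtStat : DTree → ℕ
    | DTree.W g => 2 * ml g
    | DTree.B g => ml g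
  /-- Sum of `mtStat` over the trees of a forest. -/
  def mtsum : List DTree → ℕ
    | [] => 0
    | t :: f => mtStat t + mtsum f
  /-- The statistic `ml` on duplicative forests: `1 - ℓ + Σ mtStat`. -/
  def ml : List DTree → ℕ
    | f => mtsum f + 1 - f.length
end

mutual
  /-- Number of white nodes in a duplicative tree. -/
  def whitesT : DTree → ℕ
    | DTree.W g => 1 + whitesF g
    | DTree.B g => whitesF g
  /-- Number of white nodes in a duplicative forest. -/
  def whitesF : List DTree → ℕ
    | [] => 0
    | t :: f => whitesT t + whitesF f
end

/-- Closed terms: no variables. -/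
def MClosed : MTerm → Prop
  | MTerm.M => True
  | MTerm.var _ => False
  | MTerm.app a b => MClosed a ∧ MClosed b

/-- Degree: number of applications. -/
def deg : MTerm → ℕ
  | MTerm.M => 0
  | MTerm.var _ => 0
  | MTerm.app a b => deg a + deg b + 1

/-- Subterm relation. -/
inductive Subterm : MTerm → MTerm → Prop
  | refl (t : MTerm) : Subterm t t
  | left {s a : MTerm} (b : MTerm) : Subterm s a → Subterm s (MTerm.app a b)
  | right (a : MTerm) {s b : MTerm} : Subterm s b → Subterm s (MTerm.app a b)

/-- The term `r_d`. -/
def rTerm : ℕ → MTerm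
  | 0 => MTerm.M
  | d + 1 => MTerm.app MTerm.M (rTerm d)

/-- Saturated chain from `a` to `b`, given as the list of its elements. -/
def SatChain (a b : MTerm) (c : List MTerm) : Prop :=
  List.Chain' MCovBy c ∧ c.head? = some a ∧ c.getLast? = some b

theorem DStep.white_inv {g y : List DTree} (h : DStep [DTree.W g] y) :
    y = [DTree.B (g ++ g)] ∨ ∃ g', y = [DTree.W g'] ∧ DStep g g' := by
  generalize hx : [DTree.W g] = x at h
  induction h with
  | dup g => grind
  | white h _ => grind
  | black h _ => grind
  | head f h ih => grind
  | tail t h _ =>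
    obtain ⟨rfl, rfl⟩ := List.cons.inj hx
    cases h

theorem DStep.black_inv {g y : List DTree} (h : DStep [DTree.B g] y) :
    ∃ g', y = [DTree.B g'] ∧ DStep g g' := by
  generalize hx : [DTree.B g] = x at h
  induction h with
  | dup g => grind
  | white h _ => grind
  | black h _ => grind
  | head f h ih => grind
  | tail t h _ =>
    obtain ⟨rfl, rfl⟩ := List.cons.inj hx
    cases h

theorem DLe.refl (f : List DTree) : DLe f f := Relation.ReflTransGen.refl

theorem DLe.trans {f g h : List DTree} (h₁ : DLe f g) (h₂ : DLe g h) : DLe f h :=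
  Relation.ReflTransGen.trans h₁ h₂

theorem DLe.white {g g' : List DTree} (h : DLe g g') : DLe [DTree.W g] [DTree.W g'] :=
  Relation.ReflTransGen.lift (fun g => [DTree.W g]) (fun _ _ => DStep.white) _ _ h

theorem DLe.black {g g' : List DTree} (h : DLe g g') : DLe [DTree.B g] [DTree.B g'] :=
  Relation.ReflTransGen.lift (fun g => [DTree.B g]) (fun _ _ => DStep.black) _ _ h

theorem DLe.tail (t : DTree) {f f' : List DTree} (h : DLe f f') : DLe (t :: f) (t :: f') :=
  Relation.ReflTransGen.lift (fun f => t :: f) (fun _ _ => DStep.tail t) _ _ h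

theorem DStep.exists_singleton {t : DTree} {y : List DTree} (h : DStep [t] y) :
    ∃ t', y = [t'] := by
  cases t with
  | W g => obtain h | ⟨g', h, -⟩ := h.white_inv <;> exact ⟨_, h⟩
  | B g => obtain ⟨g', h, -⟩ := h.black_inv; exact ⟨_, h⟩

theorem DLe.head {t t' : DTree} (f : List DTree) (h : DLe [t] [t']) :
    DLe (t :: f) (t' :: f) := by
  generalize hx : [t] = x at h
  induction h using Relation.ReflTransGen.head_induction_on generalizing t with
  | refl => cases hx; exact DLe.refl _
  | head h _ ih =>
    subst hx
    obtain ⟨u, rfl⟩ := h.exists_singleton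
    exact Relation.ReflTransGen.head (DStep.head f h) (ih rfl)

theorem DStep.forall₂ {f f' : List DTree} (h : DStep f f') :
    List.Forall₂ (fun a b => DLe [a] [b]) f f' := by
  induction h with
  | dup g => exact .cons (.single (.dup g)) .nil
  | white h _ => exact .cons (.single (.white h)) .nil
  | black h _ => exact .cons (.single (.black h)) .nil
  | head f h _ => exact .cons (.single h) (List.forall₂_same.2 fun a _ => DLe.refl [a])
  | tail t h ih => exact .cons (DLe.refl _) ih

theorem List.Forall₂.trans_dLe {f g h : List DTree}
    (h₁ : List.Forall₂ (fun a b => DLe [a] [b]) f g)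
    (h₂ : List.Forall₂ (fun a b => DLe [a] [b]) g h) :
    List.Forall₂ (fun a b => DLe [a] [b]) f h := by
  induction h₁ generalizing h with
  | nil => exact h₂
  | cons hab _ ih =>
    cases h₂ with
    | cons hbc ht => exact .cons (hab.trans hbc) (ih ht)

theorem dLe_iff_forall₂ {f f' : List DTree} :
    DLe f f' ↔ List.Forall₂ (fun a b => DLe [a] [b]) f f' := by
  constructor
  · intro h
    induction h with
    | refl => exact List.forall₂_same.2 fun a _ => DLe.refl [a]
    | tail _ h ih =>
      exact ih.trans_dLe h.forall₂
  · intro h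
    induction h with
    | nil => exact DLe.refl _
    | cons h _ ih => exact (DLe.head _ h).trans (DLe.tail _ ih)

theorem DLe.append {f f' g g' : List DTree} (hf : DLe f f') (hg : DLe g g') :
    DLe (f ++ g) (f' ++ g') :=
  dLe_iff_forall₂.2 (List.rel_append (dLe_iff_forall₂.1 hf) (dLe_iff_forall₂.1 hg))

theorem DLe.append_inv {f g h : List DTree} (hle : DLe (f ++ g) h) :
    ∃ f' g', h = f' ++ g' ∧ DLe f f' ∧ DLe g g' := by
  rw [dLe_iff_forall₂] at hle
  refine ⟨h.take f.length, h.drop f.length, (List.take_append_drop _ _).symm, ?_, ?_⟩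
  · simpa using dLe_iff_forall₂.2 (List.forall₂_take f.length hle)
  · simpa using dLe_iff_forall₂.2 (List.forall₂_drop f.length hle)

theorem DLe.black_inv {g y : List DTree} (h : DLe [DTree.B g] y) :
    ∃ g', y = [DTree.B g'] ∧ DLe g g' := by
  induction h with
  | refl => exact ⟨g, rfl, DLe.refl g⟩
  | tail _ hs ih =>
    obtain ⟨g₁, rfl, hg⟩ := ih
    obtain ⟨g₂, rfl, hg'⟩ := hs.black_inv
    exact ⟨g₂, rfl, Relation.ReflTransGen.tail hg hg'⟩

theorem DLe.white_inv {g y : List DTree} (h : DLe [DTree.W g] y) :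
    (∃ g' g'', y = [DTree.B (g' ++ g'')] ∧ DLe g g' ∧ DLe g g'') ∨
      ∃ g', y = [DTree.W g'] ∧ DLe g g' := by
  induction h with
  | refl => exact .inr ⟨g, rfl, DLe.refl g⟩
  | tail _ hs ih =>
    obtain ⟨g₁, g₂, rfl, h₁, h₂⟩ | ⟨g₁, rfl, hg⟩ := ih
    · obtain ⟨k, rfl, hk⟩ := hs.black_inv
      obtain ⟨k₁, k₂, rfl, hk₁, hk₂⟩ := DLe.append_inv (Relation.ReflTransGen.single hk)
      exact .inl ⟨k₁, k₂, rfl, h₁.trans hk₁, h₂.trans hk₂⟩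
    · obtain rfl | ⟨g₂, rfl, hg'⟩ := hs.white_inv
      · exact .inl ⟨g₁, g₁, rfl, hg, hg⟩
      · exact .inr ⟨g₂, rfl, Relation.ReflTransGen.tail hg hg'⟩

/-- recursive description of `≪` on duplicative forests. -/
theorem duplicative_le_iff (f f' : List DTree) :
    DLe f f' ↔ (f.length = f'.length ∧
      (f = [] ∨
       (∃ g g' g'', f = [DTree.W g] ∧ f' = [DTree.B (g' ++ g'')] ∧
         DLe g g' ∧ DLe g g'') ∨
       (∃ g g', f = [DTree.W g] ∧ f' = [DTree.W g'] ∧ DLe g g') ∨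
       (∃ g g', f = [DTree.B g] ∧ f' = [DTree.B g'] ∧ DLe g g') ∨
       (2 ≤ f.length ∧ List.Forall₂ (fun a b => DLe [a] [b]) f f'))) := by
  constructor
  · intro h
    have hall := dLe_iff_forall₂.1 h
    refine ⟨hall.length_eq, ?_⟩
    match f, h, hall with
    | [], _, _ => exact .inl rfl
    | [DTree.W g], h, _ =>
      obtain ⟨g', g'', h⟩ | ⟨g', h⟩ := h.white_inv
      · exact .inr (.inl ⟨g, g', g'', rfl, h⟩)
      · exact .inr (.inr (.inl ⟨g, g', rfl, h⟩))
    | [DTree.B g], h, _ =>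
      obtain ⟨g', h⟩ := h.black_inv
      exact .inr (.inr (.inr (.inl ⟨g, g', rfl, h⟩)))
    | _ :: _ :: _, _, hall => exact .inr (.inr (.inr (.inr ⟨by simp, hall⟩)))
  · rintro ⟨hlen, rfl | ⟨g, g', g'', rfl, rfl, h₁, h₂⟩ | ⟨g, g', rfl, rfl, h⟩ |
      ⟨g, g', rfl, rfl, h⟩ | ⟨-, h⟩⟩
    · rw [List.length_nil, eq_comm, List.length_eq_zero_iff] at hlen
      exact hlen ▸ DLe.refl _
    · exact Relation.ReflTransGen.head (DStep.dup g) (h₁.append h₂).black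
    · exact h.white
    · exact h.black
    · exact dLe_iff_forall₂.2 h
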